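/- Let β be a positive integer. There exists a constant C > 0 (depending only on β) such that for all reals x ≥ 3 one has | Σ_{d,k ≥ 1, dk ≤ x} d^{β} μ(k) − x^{1+β}/((1+β)ζ(1+β)) | ≤ C · x^{β}(log x)^{⌊1/β⌋}, where the sum runs over pairs of positive integers d, k with dk ≤ x, μ is the Möbius function, and ⌊1/β⌋ equals 1 if β = 1 and 0 if β ≥ 2. -/

import Mathlib

open Complex Finset
open scoped Classical

/-- Comparison of consecutive powers, in the form of the mean value theorem. -/
lemma pow_succ_sub_pow_succ_le {a b : ℝ} (ha : 0 ≤ a) (hab : a ≤ b) (n : ℕ) :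
    b ^ (n + 1) - a ^ (n + 1) ≤ (b - a) * ((n + 1) * b ^ n) := by
  induction n with
  | zero => simp
  | succ n ih =>
    have h1 : a ^ (n + 1) ≤ b ^ (n + 1) := by gcongr
    have h2 := mul_le_mul_of_nonneg_left ih (ha.trans hab)
    have h3 := mul_le_mul_of_nonneg_left h1 (sub_nonneg.2 hab)
    push_cast
    calc b ^ (n + 1 + 1) - a ^ (n + 1 + 1)
        = b * (b ^ (n + 1) - a ^ (n + 1)) + (b - a) * a ^ (n + 1) := by ring
      _ ≤ b * ((b - a) * ((n + 1) * b ^ n)) + (b - a) * b ^ (n + 1) := by linarith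
      _ = _ := by ring

lemma le_pow_succ_sub_pow_succ {a b : ℝ} (ha : 0 ≤ a) (hab : a ≤ b) (n : ℕ) :
    (b - a) * ((n + 1) * a ^ n) ≤ b ^ (n + 1) - a ^ (n + 1) := by
  induction n with
  | zero => simp
  | succ n ih =>
    have h1 : a ^ (n + 1) ≤ b ^ (n + 1) := by gcongr
    have h2 := mul_le_mul_of_nonneg_left ih ha
    have h3 := mul_le_mul_of_nonneg_left h1 (sub_nonneg.2 hab)
    push_cast
    calc (b - a) * ((n + 1 + 1) * a ^ (n + 1))
        = a * ((b - a) * ((n + 1) * a ^ n)) + (b - a) * a ^ (n + 1) := by ring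
      _ ≤ a * (b ^ (n + 1) - a ^ (n + 1)) + (b - a) * b ^ (n + 1) := by linarith
      _ = _ := by ring

lemma sum_Icc_pow_bounds (n : ℕ) (hn : 0 < n) (m : ℕ) :
    (m : ℝ) ^ (n + 1) / (n + 1) ≤ ∑ d ∈ Icc 1 m, (d : ℝ) ^ n ∧
      ∑ d ∈ Icc 1 m, (d : ℝ) ^ n ≤ (m : ℝ) ^ (n + 1) / (n + 1) + (m : ℝ) ^ n := by
  have hn' : (0 : ℝ) < n + 1 := by positivity
  induction m with
  | zero => simp [hn.ne']
  | succ m ih =>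
    have hm : (0 : ℝ) ≤ m := m.cast_nonneg
    have hm' : (m : ℝ) ≤ m + 1 := by linarith
    have h1 := pow_succ_sub_pow_succ_le hm hm' n
    have h2 := le_pow_succ_sub_pow_succ hm hm' n
    obtain ⟨ih1, ih2⟩ := ih
    rw [sum_Icc_succ_top (by omega)]
    push_cast
    constructor
    · have : ((m : ℝ) + 1) ^ (n + 1) / (n + 1) ≤ (m : ℝ) ^ (n + 1) / (n + 1) + (m + 1) ^ n := by
        rw [div_add' _ _ _ hn'.ne', div_le_div_iff_of_pos_right hn']
        linarith
      linarith
    · have : (m : ℝ) ^ (n + 1) / (n + 1) + m ^ n ≤ ((m : ℝ) + 1) ^ (n + 1) / (n + 1) := by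
        rw [div_add' _ _ _ hn'.ne', div_le_div_iff_of_pos_right hn']
        linarith
      linarith

lemma abs_sum_Icc_floor_pow_sub_le (n : ℕ) (hn : 0 < n) {y : ℝ} (hy : 0 ≤ y) :
    |∑ d ∈ Icc 1 ⌊y⌋₊, (d : ℝ) ^ n - y ^ (n + 1) / (n + 1)| ≤ y ^ n := by
  have hn' : (0 : ℝ) < n + 1 := by positivity
  obtain ⟨h1, h2⟩ := sum_Icc_pow_bounds n hn ⌊y⌋₊
  have hf : (⌊y⌋₊ : ℝ) ≤ y := Nat.floor_le hy
  have h3 := pow_succ_sub_pow_succ_le (Nat.cast_nonneg _) hf n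
  have h4 : (⌊y⌋₊ : ℝ) ^ n ≤ y ^ n := by gcongr
  have h5 : (⌊y⌋₊ : ℝ) ^ (n + 1) / (n + 1) ≤ y ^ (n + 1) / (n + 1) := by gcongr
  have h6 : y ^ (n + 1) / (n + 1) ≤ (⌊y⌋₊ : ℝ) ^ (n + 1) / (n + 1) + y ^ n := by
    rw [div_add' _ _ _ hn'.ne', div_le_div_iff_of_pos_right hn']
    have : (y - ⌊y⌋₊) * ((n + 1) * y ^ n) ≤ 1 * ((n + 1) * y ^ n) := by
      gcongr
      linarith [Nat.lt_floor_add_one y]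
    linarith
  rw [abs_le]
  constructor <;> linarith

lemma norm_moebius_le_one (k : ℕ) : ‖((ArithmeticFunction.moebius k : ℤ) : ℂ)‖ ≤ 1 := by
  rw [Complex.norm_intCast]
  exact_mod_cast ArithmeticFunction.abs_moebius_le_one

lemma hasSum_moebius_div_pow (n : ℕ) (hn : 0 < n) :
    HasSum (fun k : ℕ ↦ ((ArithmeticFunction.moebius k : ℤ) : ℂ) / (k : ℂ) ^ (n + 1))
      (riemannZeta (1 + n))⁻¹ := by
  have hs : 1 < (1 + (n : ℂ)).re := by simpa using hn
  have h := (ArithmeticFunction.LSeriesSummable_moebius_iff.2 hs).LSeriesHasSum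
  have hz := ArithmeticFunction.LSeries_zeta_mul_Lseries_moebius hs
  rw [ArithmeticFunction.LSeries_zeta_eq_riemannZeta hs] at hz
  rw [eq_inv_of_mul_eq_one_right hz] at h
  have heq : (fun k : ℕ ↦ ((ArithmeticFunction.moebius k : ℤ) : ℂ) / (k : ℂ) ^ (n + 1)) =
      LSeries.term (fun k ↦ ((ArithmeticFunction.moebius k : ℤ) : ℂ)) (1 + n) := by
    funext k
    rcases eq_or_ne k 0 with rfl | hk
    · simp
    · rw [LSeries.term_of_ne_zero hk, add_comm (1 : ℂ), ← Nat.cast_succ, Complex.cpow_natCast]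
  rw [heq]
  exact h

/-- Tail bound for the Dirichlet series of the Möbius function. -/
lemma norm_inv_riemannZeta_sub_sum_le (n : ℕ) (hn : 0 < n) (N : ℕ) :
    ‖(riemannZeta (1 + n))⁻¹ - ∑ k ∈ Icc 1 N,
      ((ArithmeticFunction.moebius k : ℤ) : ℂ) / (k : ℂ) ^ (n + 1)‖ ≤ 2 / ((N : ℝ) + 1) ^ n := by
  obtain ⟨n, rfl⟩ := Nat.exists_eq_succ_of_ne_zero hn.ne'
  have ht := (hasSum_moebius_div_pow _ hn).tendsto_sum_nat
  refine le_of_tendsto (ht.sub_const _).norm ?_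
  filter_upwards [Filter.eventually_ge_atTop (N + 1)] with M hM
  have hsplit : range M = Icc 0 N ∪ Ioo N M := by
    ext; simp; omega
  have hdisj : Disjoint (Icc 0 N) (Ioo N M) := by
    rw [Finset.disjoint_left]; simp; omega
  have h0 : Icc 0 N = insert 0 (Icc 1 N) := by
    ext; simp; omega
  rw [hsplit, sum_union hdisj, h0, sum_insert (by simp)]
  simp only [ArithmeticFunction.map_zero, Int.cast_zero, zero_div, zero_add, add_sub_cancel_left]
  calc _ ≤ ∑ k ∈ Ioo N M, (((N : ℝ) + 1) ^ n)⁻¹ * ((k : ℝ) ^ 2)⁻¹ := by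
        refine norm_sum_le_of_le _ fun k hk ↦ ?_
        have hk' : (N : ℝ) + 1 ≤ k := by exact_mod_cast (mem_Ioo.1 hk).1
        have hk0 : (0 : ℝ) < k := by linarith [(Nat.cast_nonneg N : (0 : ℝ) ≤ N)]
        rw [norm_div, norm_pow, Complex.norm_natCast, ← mul_inv]
        calc _ ≤ 1 / (k : ℝ) ^ (n.succ + 1) := by gcongr; exact norm_moebius_le_one k
          _ = ((k : ℝ) ^ n * k ^ 2)⁻¹ := by rw [one_div, ← pow_add]
          _ ≤ _ := by gcongr
    _ ≤ (((N : ℝ) + 1) ^ n)⁻¹ * (2 / (N + 1)) := by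
        rw [← mul_sum]
        gcongr
        exact sum_Ioo_inv_sq_le N M
    _ = _ := by
        rw [Nat.succ_eq_add_one, pow_succ]
        field_simp

lemma one_le_log_of_three_le {x : ℝ} (hx : 3 ≤ x) : 1 ≤ Real.log x := by
  rw [Real.le_log_iff_exp_le (by linarith)]
  linarith [Real.exp_one_lt_three]

lemma sum_inv_pow_le_log_pow (n : ℕ) (hn : 0 < n) {x : ℝ} (hx : 3 ≤ x) :
    ∑ k ∈ Icc 1 ⌊x⌋₊, ((k : ℝ) ^ n)⁻¹ ≤ 2 * Real.log x ^ (1 / n) := by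
  have hlog := one_le_log_of_three_le hx
  obtain rfl | hn2 : n = 1 ∨ 2 ≤ n := by omega
  · have h := harmonic_floor_le_one_add_log x (by linarith)
    rw [harmonic_eq_sum_Icc] at h
    push_cast at h
    simp only [pow_one, Nat.div_self one_pos]
    linarith
  · rw [Nat.div_eq_of_lt (by omega), pow_zero]
    have h := sum_Ioo_inv_sq_le (α := ℝ) 0 (⌊x⌋₊ + 1)
    have hI : Ioo 0 (⌊x⌋₊ + 1) = Icc 1 ⌊x⌋₊ := by ext; simp; omega
    rw [hI] at h
    refine (sum_le_sum fun k hk ↦ ?_).trans (h.trans (by norm_num))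
    have hk : (1 : ℝ) ≤ k := by exact_mod_cast (mem_Icc.1 hk).1
    gcongr

lemma sum_filter_mul_le_eq_sum_moebius_mul (n : ℕ) (x : ℝ) :
    ∑ p ∈ (Icc 1 ⌊x⌋₊ ×ˢ Icc 1 ⌊x⌋₊).filter (fun p => p.1 * p.2 ≤ ⌊x⌋₊),
        (p.1 : ℂ) ^ n * ((ArithmeticFunction.moebius p.2 : ℤ) : ℂ) =
      ∑ k ∈ Icc 1 ⌊x⌋₊, ((ArithmeticFunction.moebius k : ℤ) : ℂ) *
        ((∑ d ∈ Icc 1 ⌊x / k⌋₊, (d : ℝ) ^ n : ℝ) : ℂ) := by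
  rw [sum_filter, sum_product_right]
  refine sum_congr rfl fun k hk ↦ ?_
  have hk := (mem_Icc.1 hk).1
  rw [← sum_filter, Nat.floor_div_natCast, Complex.ofReal_sum, mul_sum]
  refine sum_congr ?_ fun d _ ↦ by push_cast; ring
  ext d
  simp only [mem_filter, mem_Icc, Nat.le_div_iff_mul_le hk]
  have : d ≤ d * k := Nat.le_mul_of_pos_right d hk
  omega

theorem moebius_power_sum (β : ℕ) (hβ : 0 < β) :
    ∃ C > 0, ∀ x : ℝ, 3 ≤ x →
      ‖(∑ p ∈ (Finset.Icc 1 ⌊x⌋₊ ×ˢ Finset.Icc 1 ⌊x⌋₊).filter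
            (fun p => p.1 * p.2 ≤ ⌊x⌋₊),
          (p.1 : ℂ) ^ β * ((ArithmeticFunction.moebius p.2 : ℤ) : ℂ)) -
          ((x ^ (1 + β) : ℝ) : ℂ) / ((1 + (β : ℂ)) * riemannZeta (1 + (β : ℂ)))‖ ≤
        C * x ^ β * (Real.log x) ^ (1 / β) := by
  refine ⟨4, by norm_num, fun x hx ↦ ?_⟩
  have hx0 : 0 < x := by linarith
  have hL : 1 ≤ Real.log x ^ (1 / β) := one_le_pow₀ (one_le_log_of_three_le hx)
  rw [sum_filter_mul_le_eq_sum_moebius_mul]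
  set T : ℂ := ∑ k ∈ Icc 1 ⌊x⌋₊,
    ((ArithmeticFunction.moebius k : ℤ) : ℂ) / (k : ℂ) ^ (β + 1) with hT
  have hmain : ‖∑ k ∈ Icc 1 ⌊x⌋₊, ((ArithmeticFunction.moebius k : ℤ) : ℂ) *
        ((∑ d ∈ Icc 1 ⌊x / k⌋₊, (d : ℝ) ^ β : ℝ) : ℂ) - (x : ℂ) ^ (β + 1) / (β + 1) * T‖ ≤
      x ^ β * (2 * Real.log x ^ (1 / β)) := by
    rw [hT, mul_sum, ← sum_sub_distrib]
    calc _ ≤ ∑ k ∈ Icc 1 ⌊x⌋₊, x ^ β * ((k : ℝ) ^ β)⁻¹ := by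
          refine norm_sum_le_of_le _ fun k _ ↦ ?_
          have h := abs_sum_Icc_floor_pow_sub_le β hβ (y := x / k) (by positivity)
          have heq : ((ArithmeticFunction.moebius k : ℤ) : ℂ) *
                ((∑ d ∈ Icc 1 ⌊x / k⌋₊, (d : ℝ) ^ β : ℝ) : ℂ) -
              (x : ℂ) ^ (β + 1) / (β + 1) *
                (((ArithmeticFunction.moebius k : ℤ) : ℂ) / (k : ℂ) ^ (β + 1)) =
              ((ArithmeticFunction.moebius k : ℤ) : ℂ) *
                ((∑ d ∈ Icc 1 ⌊x / k⌋₊, (d : ℝ) ^ β - (x / k) ^ (β + 1) / (β + 1) : ℝ) : ℂ) := by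
            push_cast
            rw [div_pow]
            ring
          rw [heq, norm_mul, Complex.norm_real, Real.norm_eq_abs, ← div_eq_mul_inv, ← div_pow,
            ← one_mul ((x / k) ^ β)]
          gcongr
          exact norm_moebius_le_one k
      _ ≤ _ := by
          rw [← mul_sum]
          gcongr
          exact sum_inv_pow_le_log_pow β hβ hx
  have htail : ‖(x : ℂ) ^ (β + 1) / (β + 1) * (T - (riemannZeta (1 + β))⁻¹)‖ ≤ 2 * x ^ β := by
    have h := norm_inv_riemannZeta_sub_sum_le β hβ ⌊x⌋₊
    have hfl : x ≤ (⌊x⌋₊ : ℝ) + 1 := (Nat.lt_floor_add_one x).le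
    have hn : ‖(β : ℂ) + 1‖ = β + 1 := by exact_mod_cast Complex.norm_natCast (β + 1)
    rw [norm_mul, norm_sub_rev, norm_div, norm_pow, Complex.norm_real, Real.norm_eq_abs,
      abs_of_pos hx0, hn]
    calc _ ≤ x ^ (β + 1) / 1 * (2 / x ^ β) := by
          gcongr
          · linarith [(Nat.cast_nonneg β : (0 : ℝ) ≤ β)]
          · exact h.trans (by gcongr)
      _ = 2 * x ^ 1 := by
          field_simp
          ring
      _ ≤ _ := by
          gcongr
          · linarith
          · exact hβ
  have heq : ((x ^ (1 + β) : ℝ) : ℂ) / ((1 + (β : ℂ)) * riemannZeta (1 + (β : ℂ))) =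
      (x : ℂ) ^ (β + 1) / (β + 1) * (riemannZeta (1 + β))⁻¹ := by
    rw [add_comm 1 β, div_mul_eq_div_div, div_eq_mul_inv _ (riemannZeta _), add_comm (β : ℂ) 1]
    push_cast
    rfl
  rw [heq]
  calc _ ≤ x ^ β * (2 * Real.log x ^ (1 / β)) + 2 * x ^ β := by
        refine (le_of_eq (congrArg _ ?_)).trans (norm_add_le_of_le hmain htail)
        ring
    _ ≤ _ := by nlinarith [pow_pos hx0 β]
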